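/- arXiv:1802.05897 — 2 statements merged into one kernel-verified Lean document; each statement's English description precedes it below -/
import Mathlib

section
/- In the ring of formal power series over ℝ, the generating function f(t) = Σ_{n≥1} w_{2n-1} t^{2n-1} of the odd-indexed terms of the generalized bi-periodic Fibonacci sequence satisfies (1 − (ab+2)t² + t⁴)·f(t) = w_1·t + (b·w_0 − w_1)·t³. -/
/-- The generalized bi-periodic Fibonacci sequence with parameters `a, b`
and initial values `w0, w1`. -/
noncomputable def w (a b w0 w1 : ℝ) : ℕ → ℝ
  | 0 => w0
  | 1 => w1
  | n + 2 => (if Even (n + 2) then a else b) * w a b w0 w1 (n + 1) + w a b w0 w1 n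

/-- The generating function `f(t) = ∑_{n ≥ 1} w_{2n-1} t^{2n-1}` of the
odd-indexed terms: its `m`-th coefficient is `w m` if `m` is odd and `0` otherwise. -/
noncomputable def oddGF (a b w0 w1 : ℝ) : PowerSeries ℝ :=
  PowerSeries.mk fun m => if Odd m then w a b w0 w1 m else 0

/-- Terms of the same parity satisfy a linear recurrence with constant coefficients. -/
theorem w_add_four (a b w0 w1 : ℝ) (n : ℕ) :
    w a b w0 w1 (n + 4) = (a * b + 2) * w a b w0 w1 (n + 2) - w a b w0 w1 n := by
  have h4 : w a b w0 w1 (n + 4) = (if Even (n + 4) then a else b) * w a b w0 w1 (n + 3) +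
      w a b w0 w1 (n + 2) := by rw [w]
  have h3 : w a b w0 w1 (n + 3) = (if Even (n + 3) then a else b) * w a b w0 w1 (n + 2) +
      w a b w0 w1 (n + 1) := by rw [w]
  have h2 : w a b w0 w1 (n + 2) = (if Even (n + 2) then a else b) * w a b w0 w1 (n + 1) +
      w a b w0 w1 n := by rw [w]
  by_cases h : Even n
  · have e4 : Even (n + 4) := by grind
    have e3 : ¬ Even (n + 3) := by grind
    have e2 : Even (n + 2) := by grind
    rw [if_pos e4] at h4
    rw [if_neg e3] at h3
    rw [if_pos e2] at h2
    linear_combination h4 + a * h3 - h2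
  · have e4 : ¬ Even (n + 4) := by grind
    have e3 : Even (n + 3) := by grind
    have e2 : ¬ Even (n + 2) := by grind
    rw [if_neg e4] at h4
    rw [if_pos e3] at h3
    rw [if_neg e2] at h2
    linear_combination h4 + b * h3 - h2

theorem stmt1 (a b w0 w1 : ℝ) (ha : a ≠ 0) (hb : b ≠ 0) :
    (1 - PowerSeries.C (R := ℝ) (a * b + 2) * PowerSeries.X ^ 2 + PowerSeries.X ^ 4) *
        oddGF a b w0 w1 =
      PowerSeries.C (R := ℝ) w1 * PowerSeries.X +
        PowerSeries.C (R := ℝ) (b * w0 - w1) * PowerSeries.X ^ 3 := by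
  have parity (n : ℕ) : (Odd (n + 4) ↔ Odd n) ∧ (Odd (n + 2) ↔ Odd n) := by
    constructor <;> grind
  have odd_three : Odd 3 := by decide
  ext m
  rw [add_mul, sub_mul, one_mul, mul_assoc]
  simp only [map_add (PowerSeries.coeff m), map_sub (PowerSeries.coeff m), PowerSeries.coeff_C_mul, PowerSeries.coeff_X_pow_mul',
    PowerSeries.coeff_X, PowerSeries.coeff_X_pow, oddGF, PowerSeries.coeff_mk]
  match m with
  | 0 => simp
  | 1 => simp [w]
  | 2 => simp [show ¬ Odd 2 by decide]
  | 3 =>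
    simp [odd_three, w, show ¬ Even 3 by decide]
    ring
  | n + 4 =>
    have h := w_add_four a b w0 w1 n
    by_cases hn : Odd n <;> simp [parity n, hn, show n + 4 - 2 = n + 2 by omega]
    linear_combination h
end

section
/- In the ring of formal power series over the real quaternions, the generating function G(t) = Σ_{n≥0} W_n t^n of the generalized bi-periodic Fibonacci quaternions satisfies (1 − b·t − t²)·G(t) = W_0 + (W_1 − b·W_0)·t + (a−b)·Σ_{s=0}^{3} R(t,s)·e_s, where f(t) = Σ_{n≥1} w_{2n-1} t^{2n-1} and R(t,s) = t^{1-s}·(f(t) − Σ_{k=1}^{⌊(s+1)/2⌋} w_{2k-1} t^{2k-1}) (each R(t,s) contains only nonnegative powers of t, so it is a well-defined formal power series). -/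
/-- The standard basis `e_0 = 1, e_1 = i, e_2 = j, e_3 = k` of the real quaternions. -/
noncomputable def e : ℕ → Quaternion ℝ
  | 0 => 1
  | 1 => ⟨0, 1, 0, 0⟩
  | 2 => ⟨0, 0, 1, 0⟩
  | _ => ⟨0, 0, 0, 1⟩

/-- The generalized bi-periodic Fibonacci quaternion `W_n = ∑_{l=0}^{3} w_{n+l} e_l`. -/
noncomputable def W (a b w0 w1 : ℝ) (n : ℕ) : Quaternion ℝ :=
  ∑ l ∈ Finset.range 4, w a b w0 w1 (n + l) • e l

/-- `f(t) = ∑_{n ≥ 1} w_{2n-1} t^{2n-1}`, as a power series over the quaternions: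
its `m`-th coefficient is `w m` if `m` is odd and `0` otherwise. -/
noncomputable def fq (a b w0 w1 : ℝ) : PowerSeries (Quaternion ℝ) :=
  PowerSeries.mk fun m => if Odd m then (w a b w0 w1 m : Quaternion ℝ) else 0

/-- `R(t,s) = t^{1-s} (f(t) - ∑_{k=1}^{⌊(s+1)/2⌋} w_{2k-1} t^{2k-1})`.
Since the subtracted sum cancels all coefficients of `f` in degrees `< s - 1`,
this is the well-defined power series whose coefficient in degree `m` is the
coefficient of degree `m + s - 1` of `f(t) - ∑_{k=1}^{⌊(s+1)/2⌋} w_{2k-1} t^{2k-1}`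
(for `s = 0`, the degree-`0` coefficient of `t · f(t)` is `0`, which agrees with
the truncated subtraction `0 + 0 - 1 = 0` since `f` has zero constant term). -/
noncomputable def R (a b w0 w1 : ℝ) (s : ℕ) : PowerSeries (Quaternion ℝ) :=
  PowerSeries.mk fun m =>
    PowerSeries.coeff (R := Quaternion ℝ) (m + s - 1)
      (fq a b w0 w1 -
        ∑ k ∈ Finset.Icc 1 ((s + 1) / 2),
          PowerSeries.C (R := Quaternion ℝ) ((w a b w0 w1 (2 * k - 1) : ℝ) : Quaternion ℝ) *
            PowerSeries.X ^ (2 * k - 1))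

lemma w_add_two (a b w0 w1 : ℝ) (n : ℕ) :
    w a b w0 w1 (n + 2) =
      b * w a b w0 w1 (n + 1) + w a b w0 w1 n +
        (a - b) * (if Odd (n + 1) then w a b w0 w1 (n + 1) else 0) := by
  rw [w]
  by_cases h : Even n
  · simp [h, Nat.even_add]
    ring
  · simp [h, Nat.even_add]

lemma coeff_R (a b w0 w1 : ℝ) (s m : ℕ) :
    PowerSeries.coeff m (R a b w0 w1 s) =
      (if Odd (m + s - 1) then (w a b w0 w1 (m + s - 1) : Quaternion ℝ) else 0) -
        ∑ k ∈ Finset.Icc 1 ((s + 1) / 2),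
          if m + s - 1 = 2 * k - 1 then (w a b w0 w1 (2 * k - 1) : Quaternion ℝ) else 0 := by
  simp [R, fq, PowerSeries.coeff_X_pow]

lemma coeff_R_of_lt_two (a b w0 w1 : ℝ) {s m : ℕ} (hm : m < 2) :
    PowerSeries.coeff m (R a b w0 w1 s) = 0 := by
  rw [coeff_R, sub_eq_zero]
  split_ifs with h
  · obtain ⟨j, hj⟩ := h
    rw [Finset.sum_eq_single (j + 1)]
    · rw [if_pos (by omega), show 2 * (j + 1) - 1 = m + s - 1 by omega]
    · intro k hk hkj
      rw [Finset.mem_Icc] at hk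
      exact if_neg (by omega)
    · intro hk
      rw [Finset.mem_Icc] at hk
      omega
  · refine (Finset.sum_eq_zero fun k hk => if_neg fun hmk => h ⟨k - 1, ?_⟩).symm
    rw [Finset.mem_Icc] at hk
    omega

lemma coeff_add_two_R (a b w0 w1 : ℝ) (s n : ℕ) :
    PowerSeries.coeff (n + 2) (R a b w0 w1 s) =
      ((if Odd (n + s + 1) then w a b w0 w1 (n + s + 1) else 0 : ℝ) : Quaternion ℝ) := by
  rw [coeff_R, Finset.sum_eq_zero, show n + 2 + s - 1 = n + s + 1 by omega, sub_zero]
  · split_ifs <;> simp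
  · intro k hk
    rw [Finset.mem_Icc] at hk
    exact if_neg (by omega)

lemma W_add_two (a b w0 w1 : ℝ) (n : ℕ) :
    W a b w0 w1 (n + 2) =
      b • W a b w0 w1 (n + 1) + W a b w0 w1 n +
        (a - b) • ∑ s ∈ Finset.range 4,
          PowerSeries.coeff (n + 2) (R a b w0 w1 s) * e s := by
  simp only [W, Finset.smul_sum, ← Finset.sum_add_distrib]
  refine Finset.sum_congr rfl fun s _ => ?_
  rw [coeff_add_two_R, Quaternion.coe_mul_eq_smul, smul_smul, smul_smul, ← add_smul, ← add_smul,
    show n + 2 + s = n + s + 2 by ring, show n + 1 + s = n + s + 1 by ring, w_add_two]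

theorem stmt3 (a b w0 w1 : ℝ) (ha : a ≠ 0) (hb : b ≠ 0) :
    (1 - PowerSeries.C (R := Quaternion ℝ) ((b : ℝ) : Quaternion ℝ) * PowerSeries.X -
          PowerSeries.X ^ 2) *
        PowerSeries.mk (fun n => W a b w0 w1 n) =
      PowerSeries.C (R := Quaternion ℝ) (W a b w0 w1 0) +
        PowerSeries.C (R := Quaternion ℝ) (W a b w0 w1 1 - b • W a b w0 w1 0) * PowerSeries.X +
        (a - b) • ∑ s ∈ Finset.range 4,
          R a b w0 w1 s * PowerSeries.C (R := Quaternion ℝ) (e s) := by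
  have hsmul (c : ℝ) (p : PowerSeries (Quaternion ℝ)) (m : ℕ) :
      PowerSeries.coeff m (c • p) = c • PowerSeries.coeff m p := rfl
  ext1 m
  rw [sub_mul, sub_mul, one_mul, mul_assoc, pow_two, mul_assoc]
  simp only [map_add, map_sub, hsmul, map_sum, PowerSeries.coeff_mul_C, PowerSeries.coeff_C_mul,
    PowerSeries.coeff_mk]
  match m with
  | 0 => simp [coeff_R_of_lt_two]
  | 1 =>
    simp [coeff_R_of_lt_two, PowerSeries.coeff_succ_X_mul, Quaternion.coe_mul_eq_smul]
  | n + 2 =>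
    simp only [PowerSeries.coeff_succ_X_mul, PowerSeries.coeff_mk, PowerSeries.coeff_C,
      Quaternion.coe_mul_eq_smul]
    rw [W_add_two]
    simp
    abel
end
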